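/- Let N ≥ 1 be a natural number and let σ be a sign pattern for N such that it is NOT the case that 4 exactly divides N and σ(4) = +1. Then the finite product ∏_{p^r ∥ N} (1 + σ(p^r)·(−𝟙[r = 2])/(p² − p − 1)) is at least the infinite product ∏_{p prime, p ≠ 2} (1 − 1/(p² − p − 1)) and at most the infinite product ∏_{p prime} (1 + 1/(p² − p − 1)), where both infinite products over primes converge (are multipliable). -/

import Mathlib

/-- `Q` exactly divides `N`: `Q ∣ N` and `gcd(Q, N/Q) = 1`. -/
def ExactlyDivides (Q N : ℕ) : Prop := Q ∣ N ∧ Nat.Coprime Q (N / Q)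

/-- A sign pattern for `N`: an integer-valued function on the exact divisors of `N` with
`σ 1 = 1`, multiplicative on coprime exact divisors, taking values `±1` on
prime powers exactly dividing `N`. -/
def IsSignPattern (N : ℕ) (σ : ℕ → ℤ) : Prop :=
  σ 1 = 1 ∧
  (∀ Q₁ Q₂ : ℕ, ExactlyDivides Q₁ N → ExactlyDivides Q₂ N → Nat.Coprime Q₁ Q₂ →
    σ (Q₁ * Q₂) = σ Q₁ * σ Q₂) ∧
  (∀ p r : ℕ, p.Prime → 1 ≤ r → ExactlyDivides (p ^ r) N →
    σ (p ^ r) = 1 ∨ σ (p ^ r) = -1)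

theorem le_prod_of_hasProd_of_le_one {ι : Type*} {f : ι → ℝ} {a : ℝ} (hf : HasProd f a)
    (h0 : ∀ i, 0 ≤ f i) (h1 : ∀ i, f i ≤ 1) (s : Finset ι) : a ≤ ∏ i ∈ s, f i := by
  classical
  refine le_of_tendsto hf ?_
  filter_upwards [Filter.eventually_ge_atTop s] with t ht
  rw [← Finset.prod_sdiff ht]
  exact mul_le_of_le_one_left (Finset.prod_nonneg fun i _ => h0 i)
    (Finset.prod_le_one (fun i _ => h0 i) fun i _ => h1 i)

theorem prod_le_of_hasProd_of_one_le {ι : Type*} {f : ι → ℝ} {a : ℝ} (hf : HasProd f a)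
    (h1 : ∀ i, 1 ≤ f i) (s : Finset ι) : ∏ i ∈ s, f i ≤ a := by
  classical
  refine ge_of_tendsto hf ?_
  filter_upwards [Filter.eventually_ge_atTop s] with t ht
  rw [← Finset.prod_sdiff ht]
  exact le_mul_of_one_le_left (Finset.prod_nonneg fun i _ => zero_le_one.trans (h1 i))
    (Finset.one_le_prod fun i _ => h1 i)

theorem sq_le_four_mul_sq_sub_sub_one {p : ℕ} (hp : 2 ≤ p) :
    (p : ℝ) ^ 2 ≤ 4 * ((p : ℝ) ^ 2 - p - 1) := by
  have h : (2 : ℝ) ≤ p := by exact_mod_cast hp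
  nlinarith

theorem one_le_sq_sub_sub_one {p : ℕ} (hp : 2 ≤ p) : (1 : ℝ) ≤ (p : ℝ) ^ 2 - p - 1 := by
  have h : (2 : ℝ) ≤ p := by exact_mod_cast hp
  nlinarith

theorem summable_one_div_sq_sub_sub_one {P : ℕ → Prop} (hP : ∀ p, P p → 2 ≤ p) :
    Summable fun p : {p : ℕ // P p} => 1 / (((p : ℕ) : ℝ) ^ 2 - ((p : ℕ) : ℝ) - 1) := by
  have hs : Summable fun p : {p : ℕ // P p} => 4 * (1 / ((p : ℕ) : ℝ) ^ 2) :=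
    ((Real.summable_one_div_nat_pow.mpr one_lt_two).mul_left 4).comp_injective
      Subtype.val_injective
  refine hs.of_nonneg_of_le (fun p => ?_) fun p => ?_
  · have := one_le_sq_sub_sub_one (hP p p.2)
    positivity
  · have h1 := one_le_sq_sub_sub_one (hP p p.2)
    have h4 := sq_le_four_mul_sq_sub_sub_one (hP p p.2)
    have h2 : (2 : ℝ) ≤ (p : ℕ) := by exact_mod_cast hP p p.2
    rw [mul_one_div, div_le_div_iff₀ (by linarith) (by positivity)]
    linarith

theorem exactlyDivides_pow_factorization {N p : ℕ} (hN : N ≠ 0) (hp : p.Prime) :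
    ExactlyDivides (p ^ N.factorization p) N :=
  ⟨Nat.ordProj_dvd N p, (Nat.coprime_ordCompl hp hN).pow_left _⟩

theorem stmt_9 (N : ℕ) (hN : 1 ≤ N) (σ : ℕ → ℤ) (hσ : IsSignPattern N σ)
    (h4 : ¬ (ExactlyDivides 4 N ∧ σ 4 = 1)) :
    Multipliable (fun p : {p : ℕ // p.Prime ∧ p ≠ 2} =>
        (1 - 1 / (((p : ℕ) : ℝ) ^ 2 - ((p : ℕ) : ℝ) - 1))) ∧
    Multipliable (fun p : {p : ℕ // p.Prime} =>
        (1 + 1 / (((p : ℕ) : ℝ) ^ 2 - ((p : ℕ) : ℝ) - 1))) ∧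
    (∏' p : {p : ℕ // p.Prime ∧ p ≠ 2}, (1 - 1 / (((p : ℕ) : ℝ) ^ 2 - ((p : ℕ) : ℝ) - 1))) ≤
      (∏ p ∈ N.primeFactors,
        (1 + (σ (p ^ N.factorization p) : ℝ) *
          (-(if N.factorization p = 2 then (1 : ℝ) else 0)) / ((p : ℝ) ^ 2 - p - 1))) ∧
    (∏ p ∈ N.primeFactors,
        (1 + (σ (p ^ N.factorization p) : ℝ) *
          (-(if N.factorization p = 2 then (1 : ℝ) else 0)) / ((p : ℝ) ^ 2 - p - 1))) ≤
      ∏' p : {p : ℕ // p.Prime}, (1 + 1 / (((p : ℕ) : ℝ) ^ 2 - ((p : ℕ) : ℝ) - 1)) := by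
  have hN0 : N ≠ 0 := by omega
  have hlow : Multipliable (fun p : {p : ℕ // p.Prime ∧ p ≠ 2} =>
      (1 - 1 / (((p : ℕ) : ℝ) ^ 2 - ((p : ℕ) : ℝ) - 1))) := by
    simp only [sub_eq_add_neg (1 : ℝ)]
    exact Real.multipliable_one_add_of_summable
      (summable_one_div_sq_sub_sub_one fun p hp => hp.1.two_le).neg
  have hupp : Multipliable (fun p : {p : ℕ // p.Prime} =>
      (1 + 1 / (((p : ℕ) : ℝ) ^ 2 - ((p : ℕ) : ℝ) - 1))) :=
    Real.multipliable_one_add_of_summable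
      (summable_one_div_sq_sub_sub_one fun p hp => hp.two_le)
  have hinv : ∀ p : ℕ, p.Prime → 0 ≤ 1 / ((p : ℝ) ^ 2 - p - 1) ∧ 1 / ((p : ℝ) ^ 2 - p - 1) ≤ 1 :=
    fun p hp => by
      have h := one_le_sq_sub_sub_one hp.two_le
      exact ⟨by positivity, by rw [div_le_one (by linarith)]; exact h⟩
  set g : ℕ → ℝ := fun p => 1 + (σ (p ^ N.factorization p) : ℝ) *
    (-(if N.factorization p = 2 then (1 : ℝ) else 0)) / ((p : ℝ) ^ 2 - p - 1) with hg
  have hbound : ∀ p ∈ N.primeFactors,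
      1 - 1 / ((p : ℝ) ^ 2 - p - 1) ≤ g p ∧ g p ≤ 1 + 1 / ((p : ℝ) ^ 2 - p - 1) := by
    intro p hp
    have hpp := Nat.prime_of_mem_primeFactors hp
    have hi := (hinv p hpp).1
    have hr : 1 ≤ N.factorization p :=
      hpp.factorization_pos_of_dvd hN0 (Nat.dvd_of_mem_primeFactors hp)
    simp only [hg]
    split_ifs
    · rcases hσ.2.2 p _ hpp hr (exactlyDivides_pow_factorization hN0 hpp) with h | h <;>
      · rw [h]
        push_cast
        constructor <;> ring_nf at hi ⊢ <;> linarith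
    · constructor <;> simp only [neg_zero, mul_zero, zero_div] <;> linarith
  have htwo : 2 ∈ N.primeFactors → 1 ≤ g 2 := by
    intro h2
    have hpp := Nat.prime_two
    simp only [hg]
    split_ifs with h
    · have hd := exactlyDivides_pow_factorization hN0 hpp
      have hs := hσ.2.2 2 _ hpp (by omega) hd
      rw [h] at hd hs ⊢
      have hs' := hs.resolve_left fun h' => h4 ⟨hd, h'⟩
      rw [hs']
      norm_num
    · simp
  refine ⟨hlow, hupp, ?_, ?_⟩
  · have hnonneg : ∀ p : ℕ, p.Prime → 0 ≤ 1 - 1 / ((p : ℝ) ^ 2 - p - 1) :=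
      fun p hp => sub_nonneg.2 (hinv p hp).2
    refine (le_prod_of_hasProd_of_le_one hlow.hasProd (fun p => hnonneg p p.2.1)
      (fun p => by have := (hinv p p.2.1).1; linarith) (N.primeFactors.subtype _)).trans ?_
    rw [Finset.prod_subtype_eq_prod_filter
      (f := fun p : ℕ => 1 - 1 / ((p : ℝ) ^ 2 - p - 1)), Finset.prod_filter]
    refine Finset.prod_le_prod (fun p hp => ?_) fun p hp => ?_
    · split_ifs with h
      · exact hnonneg p h.1
      · exact zero_le_one
    · by_cases h : p.Prime ∧ p ≠ 2
      · rw [if_pos h]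
        exact (hbound p hp).1
      · rw [if_neg h]
        have hp2 : p = 2 := by
          by_contra hne
          exact h ⟨Nat.prime_of_mem_primeFactors hp, hne⟩
        subst hp2
        exact htwo hp
  · refine le_trans ?_ (prod_le_of_hasProd_of_one_le hupp.hasProd
      (fun p => by have := (hinv p p.2).1; linarith) (N.primeFactors.subtype _))
    rw [Finset.prod_subtype_of_mem (fun p : ℕ => 1 + 1 / ((p : ℝ) ^ 2 - p - 1))
      fun p hp => Nat.prime_of_mem_primeFactors hp]
    refine Finset.prod_le_prod (fun p hp => ?_) fun p hp => (hbound p hp).2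
    have := (hinv p (Nat.prime_of_mem_primeFactors hp)).2
    linarith [(hbound p hp).1]
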